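/- Let p be a prime, let ϖ ≥ 1 be an integer coprime to p, and let (t_k)_{k≥1} be a periodic sequence of nonnegative integers with period ϖ. Then the Cesàro mean B := 𝒞(p^{−t_k · p^{v_p(k)}}) exists, and exactly one of the following holds: either t_k = 0 for all k and then B = 1, or t_a ≠ 0 for some a and then B is a transcendental real number. (This B is the Cesàro mean arising from a confined endomorphism of a vector group 𝔾_a^r over the algebraic closure of 𝔽_p with fixed-point counts σ_k = p^{kc − t_k·p^{v_p(k)}} and Λ = p^c; equivalently, from an additive cellular automaton on the alphabet 𝔽_p^r.) -/

import Mathlib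

open Filter Topology Real

noncomputable section

/-- The Cesàro mean of the real sequence `a` (indexed from `1`) equals `B`. -/
def CesaroLim (a : ℕ → ℝ) (B : ℝ) : Prop :=
  Tendsto (fun X : ℕ => (∑ k ∈ Finset.Icc 1 X, a k) / (X : ℝ)) atTop (𝓝 B)

section Sumsets

open scoped Pointwise

/-- The sums of `n` elements of `E`, repetitions allowed. -/
def nfoldSums (E : Set ℝ) (n : ℕ) : Set ℝ :=
  {x | ∃ e : Fin n → ℝ, (∀ i, e i ∈ E) ∧ ∑ i, e i = x}

lemma nfoldSums_zero (E : Set ℝ) : nfoldSums E 0 = {0} := by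
  ext x
  simp [nfoldSums, eq_comm]

lemma nfoldSums_succ (E : Set ℝ) (n : ℕ) : nfoldSums E (n + 1) = E + nfoldSums E n := by
  ext x
  rw [Set.mem_add]
  constructor
  · rintro ⟨e, he, rfl⟩
    exact ⟨e 0, he 0, ∑ i : Fin n, e i.succ, ⟨_, fun i => he _, rfl⟩,
      (Fin.sum_univ_succ e).symm⟩
  · rintro ⟨a, ha, b, ⟨e, he, rfl⟩, rfl⟩
    refine ⟨Fin.cons a e, fun i => ?_, by simp [Fin.sum_univ_succ]⟩
    refine Fin.cases ?_ (fun j => ?_) i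
    · simpa using ha
    · simpa using he j

lemma IsClosed.add_of_nonneg {A B : Set ℝ} (hA : IsClosed A) (hB : IsClosed B)
    (hA0 : ∀ a ∈ A, 0 ≤ a) (hB0 : ∀ b ∈ B, 0 ≤ b) : IsClosed (A + B) := by
  refine isClosed_of_closure_subset fun x hx => ?_
  have hK : IsCompact (A ∩ Set.Icc 0 (x + 1) + B ∩ Set.Icc 0 (x + 1)) :=
    (isCompact_Icc.inter_left hA).add (isCompact_Icc.inter_left hB)
  have hsub : Set.Iio (x + 1) ∩ (A + B) ⊆
      A ∩ Set.Icc 0 (x + 1) + B ∩ Set.Icc 0 (x + 1) := by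
    rintro _ ⟨hlt, a, ha, b, hb, rfl⟩
    have h1 := hA0 a ha
    have h2 := hB0 b hb
    simp only [Set.mem_Iio] at hlt
    exact ⟨a, ⟨ha, h1, by linarith⟩, b, ⟨hb, h2, by linarith⟩, rfl⟩
  have hx' : x ∈ closure (Set.Iio (x + 1) ∩ (A + B)) :=
    isOpen_Iio.inter_closure ⟨by simp, hx⟩
  have := closure_minimal hsub hK.isClosed hx'
  exact Set.add_subset_add Set.inter_subset_left Set.inter_subset_left this

variable {E : Set ℝ}

lemma nfoldSums_nonneg (h0 : ∀ a ∈ E, 0 ≤ a) (n : ℕ) : ∀ x ∈ nfoldSums E n, 0 ≤ x := by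
  rintro _ ⟨e, he, rfl⟩
  exact Finset.sum_nonneg fun i _ => h0 _ (he i)

lemma isClosed_nfoldSums (hE : IsClosed E) (h0 : ∀ a ∈ E, 0 ≤ a) (n : ℕ) :
    IsClosed (nfoldSums E n) := by
  induction n with
  | zero => rw [nfoldSums_zero]; exact isClosed_singleton
  | succ n ih => rw [nfoldSums_succ]; exact hE.add_of_nonneg ih h0 (nfoldSums_nonneg h0 n)

lemma countable_nfoldSums (hE : E.Countable) (n : ℕ) : (nfoldSums E n).Countable := by
  induction n with
  | zero => rw [nfoldSums_zero]; exact Set.countable_singleton _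
  | succ n ih => rw [nfoldSums_succ]; exact hE.image2 ih _

lemma nfoldSums_mono (hz : (0 : ℝ) ∈ E) : Monotone (nfoldSums E) := by
  refine monotone_nat_of_le_succ fun n x hx => ?_
  rw [nfoldSums_succ]
  exact ⟨0, hz, x, hx, zero_add x⟩

lemma zero_mem_nfoldSums (hz : (0 : ℝ) ∈ E) (n : ℕ) : (0 : ℝ) ∈ nfoldSums E n :=
  ⟨fun _ => 0, fun _ => hz, by simp⟩

/-- A nonempty countable closed set cannot be stable under adding arbitrarily small positive
elements. -/
lemma exists_mem_nfoldSums_succ_notMem (hE : IsClosed E) (hc : E.Countable)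
    (h0 : ∀ a ∈ E, 0 ≤ a) (hz : (0 : ℝ) ∈ E) (hsmall : ∀ ε > 0, ∃ e ∈ E, 0 < e ∧ e < ε) (n : ℕ) :
    ∃ N ∈ nfoldSums E (n + 1), N ∉ nfoldSums E n := by
  by_contra! hsub
  have hperf : Perfect (nfoldSums E n) := by
    refine ⟨isClosed_nfoldSums hE h0 n, preperfect_iff_nhds.2 fun x hx U hU => ?_⟩
    obtain ⟨ε, hε, hball⟩ := Metric.mem_nhds_iff.1 hU
    obtain ⟨e, he, hpos, hlt⟩ := hsmall ε hε
    refine ⟨e + x, ⟨hball ?_, hsub _ ?_⟩, by linarith⟩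
    · simpa [Real.dist_eq, abs_of_pos hpos] using hlt
    · rw [nfoldSums_succ]
      exact Set.add_mem_add he hx
  obtain ⟨f, hf, -, hinj⟩ := hperf.exists_nat_bool_injection ⟨0, zero_mem_nfoldSums hz n⟩
  have hcount : (f ⁻¹' nfoldSums E n).Countable :=
    (countable_nfoldSums hc n).preimage_of_injOn hinj.injOn
  rw [Set.preimage_eq_univ_iff.2 hf, Set.countable_univ_iff] at hcount
  have hle := Cardinal.mk_le_aleph0_iff.2 hcount
  rw [← Cardinal.power_def, Cardinal.mk_bool, Cardinal.mk_nat] at hle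
  exact absurd hle (Cardinal.cantor _).not_ge

/-- Near some `(n + 1)`-fold sum there is no `n`-fold sum, and to the left of it there is a gap
in the set of `(n + 1)`-fold sums. -/
lemma exists_gap_nfoldSums (hE : IsClosed E) (hc : E.Countable)
    (h0 : ∀ a ∈ E, 0 ≤ a) (hz : (0 : ℝ) ∈ E) (hsmall : ∀ ε > 0, ∃ e ∈ E, 0 < e ∧ e < ε) (n : ℕ) :
    ∃ x y N z : ℝ, 0 ≤ x ∧ x < y ∧ y ≤ N ∧ N < z ∧ N ∈ nfoldSums E (n + 1) ∧
      N ∉ nfoldSums E n ∧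
      (∀ s ∈ nfoldSums E (n + 1), s ≤ x ∨ y ≤ s) ∧ (∀ s ∈ nfoldSums E n, s ≤ x ∨ z ≤ s) := by
  obtain ⟨N, hN, hN'⟩ := exists_mem_nfoldSums_succ_notMem hE hc h0 hz hsmall n
  obtain ⟨δ, hδ, hball⟩ := Metric.isOpen_iff.1 (isClosed_nfoldSums hE h0 n).isOpen_compl N hN'
  obtain ⟨c, hcmem, hc1, hc2⟩ := ((countable_nfoldSums hc (n + 1)).dense_compl ℝ).exists_between
    (show N - δ < N by linarith)
  obtain ⟨η, hη, hball'⟩ := Metric.isOpen_iff.1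
    (isClosed_nfoldSums hE h0 (n + 1)).isOpen_compl c hcmem
  have key : ∀ s ∈ nfoldSums E n, s ≤ max (N - δ) (c - η) ∨ N + δ ≤ s := by
    intro s hs
    by_contra! hcon
    refine hball (a := s) ?_ hs
    rw [Metric.mem_ball, Real.dist_eq, abs_lt]
    have := le_max_left (N - δ) (c - η)
    constructor <;> linarith [hcon.1, hcon.2]
  have key' : ∀ s ∈ nfoldSums E (n + 1), s ≤ max (N - δ) (c - η) ∨ min (c + η) N ≤ s := by
    intro s hs
    by_contra! hcon
    refine hball' (a := s) ?_ hs
    rw [Metric.mem_ball, Real.dist_eq, abs_lt]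
    have := le_max_right (N - δ) (c - η)
    have := min_le_left (c + η) N
    constructor <;> linarith [hcon.1, hcon.2]
  have hNn := nfoldSums_nonneg h0 _ N hN
  refine ⟨max (N - δ) (c - η), min (c + η) N, N, N + δ, ?_, ?_, min_le_right _ _, by linarith,
    hN, hN', key', key⟩
  · exact (key 0 (zero_mem_nfoldSums hz n)).resolve_right (by linarith)
  · exact max_lt (lt_min (by linarith) (by linarith)) (lt_min (by linarith) (by linarith))

end Sumsets

section Dilates

variable {p : ℕ} {A : Finset ℕ} {t : ℕ → ℕ}

/-- Zero together with all `t a * p ^ w` for `a ∈ A` and `w : ℤ`. -/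
def powDilates (p : ℕ) (A : Finset ℕ) (t : ℕ → ℕ) : Set ℝ :=
  {x | x = 0 ∨ ∃ a ∈ A, ∃ w : ℤ, x = t a * (p : ℝ) ^ w}

lemma powDilates_nonneg : ∀ x ∈ powDilates p A t, 0 ≤ x := by
  rintro x (rfl | ⟨a, -, w, rfl⟩)
  · rfl
  · positivity

lemma countable_powDilates : (powDilates p A t).Countable := by
  have : powDilates p A t ⊆
      insert 0 (Set.range fun q : ℕ × ℤ => (t q.1 : ℝ) * (p : ℝ) ^ q.2) := by
    rintro x (rfl | ⟨a, -, w, rfl⟩)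
    · exact Set.mem_insert _ _
    · exact Set.mem_insert_of_mem _ ⟨(a, w), rfl⟩
  exact ((Set.countable_range _).insert 0).mono this

lemma isClosed_insert_zero_range_mul_zpow (hp : 1 < p) {c : ℝ} (hc : 0 < c) :
    IsClosed {x : ℝ | x = 0 ∨ ∃ w : ℤ, x = c * (p : ℝ) ^ w} := by
  have hp1 : (1 : ℝ) < p := by exact_mod_cast hp
  refine isClosed_of_closure_subset fun x hx => ?_
  obtain ⟨u, hu, hlim⟩ := mem_closure_iff_seq_limit.1 hx
  have hx0 : 0 ≤ x := by
    refine ge_of_tendsto' hlim fun n => ?_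
    rcases hu n with h | ⟨w, h⟩ <;> rw [h]
    positivity
  rcases hx0.eq_or_lt with h | hpos
  · exact Or.inl h.symm
  right
  have hlog : Tendsto (fun n => Real.logb p (u n / c)) atTop (𝓝 (Real.logb p (x / c))) :=
    (hlim.div_const c).logb (by positivity)
  have hint : Real.logb p (x / c) ∈ Set.range ((↑) : ℤ → ℝ) := by
    refine Int.isClosedEmbedding_coe_real.isClosed_range.mem_of_tendsto hlog ?_
    filter_upwards [hlim.eventually (lt_mem_nhds hpos)] with n hn
    rcases hu n with h | ⟨w, h⟩
    · exact absurd h hn.ne'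
    · refine ⟨w, ?_⟩
      rw [h, mul_div_cancel_left₀ _ hc.ne', ← Real.rpow_intCast,
        Real.logb_rpow (by positivity) hp1.ne']
  obtain ⟨w, hw⟩ := hint
  refine ⟨w, ?_⟩
  have := Real.rpow_logb (by positivity) hp1.ne' (show 0 < x / c by positivity)
  rw [← hw, Real.rpow_intCast] at this
  rw [this]
  field_simp

lemma isClosed_powDilates (hp : 1 < p) (ht : ∀ a ∈ A, 0 < t a) :
    IsClosed (powDilates p A t) := by
  have : powDilates p A t =
      {0} ∪ ⋃ a ∈ A, {x : ℝ | x = 0 ∨ ∃ w : ℤ, x = t a * (p : ℝ) ^ w} := by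
    ext x
    simp only [powDilates, Set.mem_ofPred_eq, Set.mem_union, Set.mem_singleton_iff, Set.mem_iUnion]
    grind
  rw [this]
  exact isClosed_singleton.union (A.finite_toSet.isClosed_biUnion fun a ha =>
    isClosed_insert_zero_range_mul_zpow hp (by exact_mod_cast ht a ha))

lemma exists_small_mem_powDilates (hp : 1 < p) (hA : A.Nonempty) (ht : ∀ a ∈ A, 0 < t a)
    (ε : ℝ) (hε : 0 < ε) : ∃ e ∈ powDilates p A t, 0 < e ∧ e < ε := by
  obtain ⟨a, ha⟩ := hA
  have hp1 : (1 : ℝ) < p := by exact_mod_cast hp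
  have hta : (0 : ℝ) < t a := by exact_mod_cast ht a ha
  obtain ⟨n, hn⟩ := exists_pow_lt_of_lt_one (show 0 < ε / t a by positivity)
    (inv_lt_one_of_one_lt₀ hp1)
  refine ⟨t a * (p : ℝ) ^ (-(n : ℤ)), Or.inr ⟨a, ha, _, rfl⟩, by positivity, ?_⟩
  rw [lt_div_iff₀ hta] at hn
  rw [zpow_neg, zpow_natCast, ← inv_pow]
  linarith

end Dilates

section Transcendence

open Finset

variable {p : ℕ} {A : Finset ℕ} {t : ℕ → ℕ}

/-- The sum of the exponents `v` over a tuple of pairs `(a, v)`. -/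
def expSum {j : ℕ} (g : Fin j → ℕ × ℕ) : ℕ := ∑ k, (g k).2

/-- The sum of the weights `t a * p ^ v` over a tuple of pairs `(a, v)`. -/
def weightSum (p : ℕ) (t : ℕ → ℕ) {j : ℕ} (g : Fin j → ℕ × ℕ) : ℕ :=
  ∑ k, t (g k).1 * p ^ (g k).2

/-- The `n`-th partial sum of `∑ a ∈ A, ∑' v, p ^ (-(v + t a * p ^ v))`. -/
def gapPartialSum (p : ℕ) (A : Finset ℕ) (t : ℕ → ℕ) (n : ℕ) : ℝ :=
  ∑ i ∈ A ×ˢ range n, ((p : ℝ) ^ (i.2 + t i.1 * p ^ i.2))⁻¹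

lemma gapPartialSum_pow (n j : ℕ) :
    gapPartialSum p A t n ^ j = ∑ g ∈ Fintype.piFinset fun _ : Fin j => A ×ˢ range n,
      ((p : ℝ) ^ (expSum g + weightSum p t g))⁻¹ := by
  rw [gapPartialSum, sum_pow']
  refine sum_congr rfl fun g _ => ?_
  rw [prod_inv_distrib, prod_pow_eq_pow_sum, sum_add_distrib, expSum, weightSum]

lemma weightSum_div_mem_nfoldSums (hp : 1 < p) {j : ℕ} {g : Fin j → ℕ × ℕ}
    (hg : ∀ k, (g k).1 ∈ A) (m : ℕ) :
    (weightSum p t g : ℝ) / (p : ℝ) ^ m ∈ nfoldSums (powDilates p A t) j := by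
  have hp0 : (p : ℝ) ≠ 0 := by positivity
  refine ⟨fun k => t (g k).1 * (p : ℝ) ^ (((g k).2 : ℤ) - m),
    fun k => Or.inr ⟨_, hg k, _, rfl⟩, ?_⟩
  rw [weightSum, Nat.cast_sum, sum_div]
  refine sum_congr rfl fun k _ => ?_
  simp only [zpow_sub₀ hp0]
  simp [mul_div_assoc]

lemma sum_inv_pow_le_two (hp : 1 < p) (n : ℕ) : ∑ v ∈ range n, ((p : ℝ) ^ v)⁻¹ ≤ 2 := by
  have hp2 : (2 : ℝ) ≤ p := by exact_mod_cast hp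
  refine le_trans (sum_le_sum fun v _ => ?_) (sum_geometric_two_le n)
  rw [one_div, inv_pow]
  gcongr

lemma sum_weight_ge_le (hp : 1 < p) (n j : ℕ) {F : Finset (Fin j → ℕ × ℕ)}
    (hF : F ⊆ Fintype.piFinset fun _ : Fin j => A ×ˢ range n) (c : ℝ)
    (hc : ∀ g ∈ F, c ≤ weightSum p t g) :
    ∑ g ∈ F, ((p : ℝ) ^ (expSum g + weightSum p t g))⁻¹ ≤
      (2 * #A : ℝ) ^ j * (p : ℝ) ^ (-c) := by
  have hp1 : (1 : ℝ) ≤ p := by exact_mod_cast hp.le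
  have hp0 : (0 : ℝ) < p := by positivity
  calc ∑ g ∈ F, ((p : ℝ) ^ (expSum g + weightSum p t g))⁻¹
      ≤ ∑ g ∈ F, ((p : ℝ) ^ expSum g)⁻¹ * (p : ℝ) ^ (-c) := by
        refine sum_le_sum fun g hg => ?_
        rw [pow_add, mul_inv, ← Real.rpow_natCast _ (weightSum p t g), ← Real.rpow_neg hp0.le]
        gcongr
        exact hc g hg
    _ = (∑ g ∈ F, ((p : ℝ) ^ expSum g)⁻¹) * (p : ℝ) ^ (-c) := by rw [sum_mul]
    _ ≤ (2 * #A : ℝ) ^ j * (p : ℝ) ^ (-c) := by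
        gcongr
        calc ∑ g ∈ F, ((p : ℝ) ^ expSum g)⁻¹
            ≤ ∑ g ∈ Fintype.piFinset fun _ : Fin j => A ×ˢ range n, ((p : ℝ) ^ expSum g)⁻¹ :=
              sum_le_sum_of_subset_of_nonneg hF fun _ _ _ => by positivity
          _ = (∑ i ∈ A ×ˢ range n, ((p : ℝ) ^ i.2)⁻¹) ^ j := by
              rw [sum_pow']
              refine sum_congr rfl fun g _ => ?_
              rw [prod_inv_distrib, prod_pow_eq_pow_sum, expSum]
          _ ≤ (2 * #A : ℝ) ^ j := by
              gcongr
              rw [sum_product, mul_comm, ← nsmul_eq_mul]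
              exact sum_le_card_nsmul _ _ _ fun _ _ => sum_inv_pow_le_two hp n

lemma inv_pow_add_mul_pow_le (hp : 1 < p) (s k : ℕ) :
    ((p : ℝ) ^ (k + s * p ^ k))⁻¹ ≤ (1 / 2) ^ k := by
  have hp2 : (2 : ℝ) ≤ p := by exact_mod_cast hp
  rw [one_div, inv_pow]
  gcongr
  calc (2 : ℝ) ^ k ≤ (p : ℝ) ^ k := by gcongr
    _ ≤ _ := by
      gcongr
      · linarith
      · omega

lemma summable_inv_pow_add_mul_pow (hp : 1 < p) (s : ℕ) :
    Summable fun v : ℕ => ((p : ℝ) ^ (v + s * p ^ v))⁻¹ :=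
  Summable.of_nonneg_of_le (fun _ => by positivity) (inv_pow_add_mul_pow_le hp s)
    summable_geometric_two

lemma tsum_inv_pow_add_mul_pow_le (hp : 1 < p) {s : ℕ} (hs : 0 < s) (n : ℕ) :
    ∑' v : ℕ, ((p : ℝ) ^ ((v + n) + s * p ^ (v + n)))⁻¹ ≤ 2 * ((p : ℝ) ^ (p ^ n))⁻¹ := by
  have hp2 : (2 : ℝ) ≤ p := by exact_mod_cast hp
  have hp1 : (1 : ℝ) ≤ p := by linarith
  have hterm : ∀ v : ℕ, ((p : ℝ) ^ ((v + n) + s * p ^ (v + n)))⁻¹ ≤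
      (1 / 2) ^ v * ((p : ℝ) ^ (p ^ n))⁻¹ := by
    intro v
    have hexp : v + p ^ n ≤ (v + n) + s * p ^ (v + n) := by
      have h1 : p ^ n ≤ p ^ (v + n) := Nat.pow_le_pow_right (by omega) (by omega)
      have h2 : p ^ (v + n) ≤ s * p ^ (v + n) := Nat.le_mul_of_pos_left _ hs
      linarith
    calc ((p : ℝ) ^ ((v + n) + s * p ^ (v + n)))⁻¹
        ≤ ((p : ℝ) ^ (v + p ^ n))⁻¹ :=
          inv_anti₀ (by positivity) (pow_le_pow_right₀ hp1 hexp)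
      _ = ((p : ℝ) ^ v)⁻¹ * ((p : ℝ) ^ (p ^ n))⁻¹ := by rw [pow_add, mul_inv]
      _ ≤ (1 / 2) ^ v * ((p : ℝ) ^ (p ^ n))⁻¹ := by
          refine mul_le_mul_of_nonneg_right ?_ (by positivity)
          rw [one_div, inv_pow]
          gcongr
  have hsum : Summable fun v : ℕ => (1 / 2 : ℝ) ^ v * ((p : ℝ) ^ (p ^ n))⁻¹ :=
    summable_geometric_two.mul_right _
  have hsum' : Summable fun v : ℕ => ((p : ℝ) ^ ((v + n) + s * p ^ (v + n)))⁻¹ :=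
    hsum.of_nonneg_of_le (fun _ => by positivity) hterm
  refine (hsum'.tsum_le_tsum hterm hsum).trans_eq ?_
  rw [tsum_mul_right, tsum_geometric_two]

lemma abs_gapPartialSum_sub_le (hp : 1 < p) (ht : ∀ a ∈ A, 0 < t a) (n : ℕ) :
    |gapPartialSum p A t n - ∑ a ∈ A, ∑' v : ℕ, ((p : ℝ) ^ (v + t a * p ^ v))⁻¹| ≤
      2 * #A * ((p : ℝ) ^ (p ^ n))⁻¹ := by
  have hsplit : ∑ a ∈ A, ∑' v : ℕ, ((p : ℝ) ^ (v + t a * p ^ v))⁻¹ - gapPartialSum p A t n =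
      ∑ a ∈ A, ∑' v : ℕ, ((p : ℝ) ^ ((v + n) + t a * p ^ (v + n)))⁻¹ := by
    rw [gapPartialSum, sum_product, ← sum_sub_distrib]
    refine sum_congr rfl fun a _ => ?_
    rw [← (summable_inv_pow_add_mul_pow hp (t a)).sum_add_tsum_nat_add n]
    ring
  rw [abs_sub_comm, hsplit,
    abs_of_nonneg (sum_nonneg fun _ _ => tsum_nonneg fun _ => by positivity)]
  refine (sum_le_card_nsmul _ _ _ fun a ha => tsum_inv_pow_add_mul_pow_le hp (ht a ha) n).trans_eq ?_
  rw [nsmul_eq_mul]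
  ring

lemma tendsto_pow_mul_rpow_neg_pow (hp : 1 < p) (C : ℝ) (d K : ℕ) {c : ℝ} (hc : 0 < c) :
    Tendsto (fun m : ℕ => C * (p : ℝ) ^ (d * (m + K)) * (p : ℝ) ^ (-(c * (p : ℝ) ^ m)))
      atTop (𝓝 0) := by
  have hp1 : (1 : ℝ) < p := by exact_mod_cast hp
  have hp0 : (0 : ℝ) < p := by positivity
  have h := ((tendsto_rpow_mul_exp_neg_mul_atTop_nhds_zero d (c * Real.log p)
    (mul_pos hc (Real.log_pos hp1))).comp (tendsto_pow_atTop_atTop_of_one_lt hp1)).const_mul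
    (C * (p : ℝ) ^ (d * K))
  rw [mul_zero] at h
  refine h.congr fun m => ?_
  simp only [Function.comp_apply]
  rw [Real.rpow_natCast, Real.rpow_def_of_pos hp0, mul_add, pow_add, ← pow_mul, mul_comm m d]
  ring_nf

lemma sum_notMem_nfoldSums_ne_zero {E : Set ℝ} {n : ℕ} {e : Fin (n + 1) → ℝ}
    (he : ∀ i, e i ∈ E) (hsum : ∑ i, e i ∉ nfoldSums E n) (i : Fin (n + 1)) : e i ≠ 0 := by
  intro h
  refine hsum ⟨fun k => e (i.succAbove k), fun k => he _, ?_⟩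
  rw [Fin.sum_univ_succAbove e i, h, zero_add]

lemma exists_weightSum_eq (hp : 1 < p) {n : ℕ} {N : ℝ}
    (hN : N ∈ nfoldSums (powDilates p A t) (n + 1))
    (hN' : N ∉ nfoldSums (powDilates p A t) n) :
    ∃ K₀ : ℕ, ∀ K ≥ K₀, ∀ m ≥ K₀,
      ∃ g ∈ Fintype.piFinset fun _ : Fin (n + 1) => A ×ˢ range (m + K),
        (weightSum p t g : ℝ) = N * (p : ℝ) ^ m := by
  obtain ⟨e, he, rfl⟩ := hN
  have hrep : ∀ i, ∃ a ∈ A, ∃ w : ℤ, e i = t a * (p : ℝ) ^ w := fun i =>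
    (he i).resolve_left (sum_notMem_nfoldSums_ne_zero he hN' i)
  choose a ha w hw using hrep
  have hp0 : (p : ℝ) ≠ 0 := by positivity
  have hle : ∀ i, (w i).natAbs ≤ ∑ k, (w k).natAbs := fun i =>
    single_le_sum (f := fun k => (w k).natAbs) (fun _ _ => Nat.zero_le _) (mem_univ i)
  refine ⟨∑ k, (w k).natAbs + 1, fun K hK m hm => ⟨fun i => (a i, (m + w i).toNat), ?_, ?_⟩⟩
  · refine Fintype.mem_piFinset.2 fun i => mem_product.2 ⟨ha i, mem_range.2 ?_⟩
    have := hle i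
    dsimp only
    omega
  · rw [weightSum, Nat.cast_sum, sum_mul]
    refine sum_congr rfl fun i _ => ?_
    have h : (((m + w i).toNat : ℕ) : ℤ) = m + w i := by
      have := hle i
      omega
    have hpow : (p : ℝ) ^ ((m : ℤ) + w i) = (p : ℝ) ^ (m + w i).toNat := by
      rw [← zpow_natCast, h]
    rw [hw i, mul_assoc, ← zpow_natCast (p : ℝ) m, ← zpow_add₀ hp0, add_comm (w i), hpow]
    simp only [Nat.cast_mul, Nat.cast_pow]

/-- Splitting the expansion of `Q` at a partial sum according to the weight of the terms: terms of
small weight have a common small denominator, and no terms of weight between `x` and `y` occur. -/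
lemma aeval_gapPartialSum_eq (hp : 1 < p) {Q : Polynomial ℤ} {n : ℕ} (hQ : Q.natDegree = n + 1)
    {x y N z : ℝ} (hxy : x < y) (hyN : y ≤ N) (hNz : N < z)
    (hgap : ∀ s ∈ nfoldSums (powDilates p A t) (n + 1), s ≤ x ∨ y ≤ s)
    (hgap' : ∀ j ≤ n, ∀ s ∈ nfoldSums (powDilates p A t) j, s ≤ x ∨ z ≤ s) (m L : ℕ)
    (hg : ∃ g ∈ Fintype.piFinset fun _ : Fin (n + 1) => A ×ˢ range L,
      (weightSum p t g : ℝ) = N * (p : ℝ) ^ m) :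
    ∃ (Z : ℤ) (mid high : ℝ),
      Polynomial.aeval (gapPartialSum p A t L) Q =
        Z / (p : ℝ) ^ (⌊x * (p : ℝ) ^ m⌋₊ + (n + 1) * L) + mid + high ∧
      |high| ≤ (∑ j ∈ range (n + 2), |(Q.coeff j : ℝ)| * (2 * #A : ℝ) ^ j) *
        (p : ℝ) ^ (-(z * (p : ℝ) ^ m)) ∧
      |mid| ≤ (∑ j ∈ range (n + 2), |(Q.coeff j : ℝ)| * (2 * #A : ℝ) ^ j) *
        (p : ℝ) ^ (-(y * (p : ℝ) ^ m)) ∧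
      (p : ℝ) ^ (-(N * (p : ℝ) ^ m)) * ((p : ℝ) ^ ((n + 1) * L))⁻¹ ≤ |mid| := by
  have hp0 : (0 : ℝ) < p := by positivity
  have hp1 : (1 : ℝ) ≤ p := by exact_mod_cast hp.le
  have hM : (0 : ℝ) < (p : ℝ) ^ m := by positivity
  set M : ℝ := (p : ℝ) ^ m with hMdef
  let P : ∀ j : ℕ, Finset (Fin j → ℕ × ℕ) := fun j => Fintype.piFinset fun _ => A ×ˢ range L
  let f : ∀ j : ℕ, (Fin j → ℕ × ℕ) → ℝ := fun j g =>
    ((p : ℝ) ^ (expSum g + weightSum p t g))⁻¹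
  let lowS : ∀ j : ℕ, Finset (Fin j → ℕ × ℕ) := fun j =>
    (P j).filter fun g => (weightSum p t g : ℝ) ≤ x * M
  let highS : ∀ j : ℕ, Finset (Fin j → ℕ × ℕ) := fun j =>
    (P j).filter fun g => z * M ≤ (weightSum p t g : ℝ)
  let midS : Finset (Fin (n + 1) → ℕ × ℕ) :=
    (P (n + 1)).filter fun g => x * M < (weightSum p t g : ℝ) ∧ (weightSum p t g : ℝ) < z * M
  have hf0 : ∀ (j : ℕ) (F : Finset (Fin j → ℕ × ℕ)), 0 ≤ ∑ g ∈ F, f j g := fun j F =>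
    sum_nonneg fun _ _ => by positivity
  have hmemA : ∀ {j : ℕ} {g : Fin j → ℕ × ℕ}, g ∈ P j → ∀ k, (g k).1 ∈ A := fun hgP k =>
    (mem_product.1 (Fintype.mem_piFinset.1 hgP k)).1
  have hxz : x * M < z * M := by gcongr; linarith
  have hsplit : ∀ j ≤ n, ∑ g ∈ P j, f j g = ∑ g ∈ lowS j, f j g + ∑ g ∈ highS j, f j g := by
    intro j hj
    rw [← sum_filter_add_sum_filter_not (P j) (fun g => (weightSum p t g : ℝ) ≤ x * M)]
    congr 1
    refine sum_congr (filter_congr fun g hgP => ?_) fun _ _ => rfl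
    rw [not_le]
    refine ⟨fun h => ?_, fun h => hxz.trans_le h⟩
    rcases hgap' j hj _ (weightSum_div_mem_nfoldSums hp (hmemA hgP) m) with h' | h'
    · rw [div_le_iff₀ hM] at h'
      exact absurd h' h.not_ge
    · rwa [le_div_iff₀ hM] at h'
  have hsplit' : ∑ g ∈ P (n + 1), f (n + 1) g =
      ∑ g ∈ lowS (n + 1), f (n + 1) g + ∑ g ∈ midS, f (n + 1) g +
        ∑ g ∈ highS (n + 1), f (n + 1) g := by
    rw [← sum_filter_add_sum_filter_not (P (n + 1))
      (fun g => (weightSum p t g : ℝ) ≤ x * M), add_assoc]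
    congr 1
    rw [← sum_filter_add_sum_filter_not _ (fun g => (weightSum p t g : ℝ) < z * M),
      filter_filter, filter_filter]
    congr 1 <;> refine sum_congr (filter_congr fun g _ => ?_) fun _ _ => rfl
    · rw [not_le]
    · rw [not_le, not_lt]
      exact ⟨fun h => h.2, fun h => ⟨hxz.trans_le h, h⟩⟩
  have hcoef : (1 : ℝ) ≤ |(Q.coeff (n + 1) : ℝ)| := by
    have : Q.coeff (n + 1) ≠ 0 := by
      rw [← hQ]
      exact Polynomial.leadingCoeff_ne_zero.2 fun h => by simp [h] at hQ
    exact_mod_cast Int.one_le_abs this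
  have hexp : ∀ {j : ℕ} {g : Fin j → ℕ × ℕ}, g ∈ P j → j ≤ n + 1 → expSum g ≤ (n + 1) * L := by
    intro j g hgP hj
    calc expSum g ≤ ∑ _k : Fin j, L := sum_le_sum fun k _ =>
          (mem_range.1 (mem_product.1 (Fintype.mem_piFinset.1 hgP k)).2).le
      _ = j * L := by simp
      _ ≤ (n + 1) * L := Nat.mul_le_mul_right _ hj
  set D : ℕ := ⌊x * M⌋₊ + (n + 1) * L with hD
  let Z : ℤ := ∑ j ∈ range (n + 2), Q.coeff j *
    ∑ g ∈ lowS j, (p : ℤ) ^ (D - (expSum g + weightSum p t g))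
  refine ⟨Z, Q.coeff (n + 1) * ∑ g ∈ midS, f (n + 1) g,
    ∑ j ∈ range (n + 2), Q.coeff j * ∑ g ∈ highS j, f j g, ?_, ?_, ?_, ?_⟩
  · have hZ : (Z : ℝ) / (p : ℝ) ^ D =
        ∑ j ∈ range (n + 2), (Q.coeff j : ℝ) * ∑ g ∈ lowS j, f j g := by
      simp only [Z, Int.cast_sum, Int.cast_mul, Int.cast_pow, Int.cast_natCast, sum_div]
      refine sum_congr rfl fun j hj => ?_
      rw [mul_div_assoc, sum_div]
      congr 1
      refine sum_congr rfl fun g hgl => ?_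
      obtain ⟨hgP, hgx⟩ := mem_filter.1 hgl
      have h1 := hexp hgP (Nat.lt_succ_iff.1 (mem_range.1 hj))
      have h2 : weightSum p t g ≤ ⌊x * M⌋₊ := Nat.le_floor hgx
      rw [div_eq_iff (by positivity)]
      simp only [f]
      rw [pow_sub₀ _ hp0.ne' (by omega), mul_comm]
    rw [hZ, Polynomial.aeval_eq_sum_range, hQ]
    simp only [gapPartialSum_pow, zsmul_eq_mul]
    change ∑ j ∈ range (n + 1 + 1), (Q.coeff j : ℝ) * ∑ g ∈ P j, f j g = _
    have hlow : ∑ j ∈ range (n + 1), (Q.coeff j : ℝ) * ∑ g ∈ P j, f j g =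
        ∑ j ∈ range (n + 1), (Q.coeff j : ℝ) * ∑ g ∈ lowS j, f j g +
          ∑ j ∈ range (n + 1), (Q.coeff j : ℝ) * ∑ g ∈ highS j, f j g := by
      rw [← sum_add_distrib]
      refine sum_congr rfl fun j hj => ?_
      rw [hsplit j (Nat.lt_succ_iff.1 (mem_range.1 hj)), mul_add]
    rw [sum_range_succ, hlow, hsplit', sum_range_succ _ (n + 1), sum_range_succ _ (n + 1)]
    ring
  · rw [sum_mul]
    refine (abs_sum_le_sum_abs _ _).trans (sum_le_sum fun j _ => ?_)
    rw [abs_mul, mul_assoc, abs_of_nonneg (hf0 _ _)]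
    gcongr
    exact sum_weight_ge_le hp L j (filter_subset _ _) _ fun g hgh => (mem_filter.1 hgh).2
  · have h1 : ∑ g ∈ midS, f (n + 1) g ≤ (2 * #A : ℝ) ^ (n + 1) * (p : ℝ) ^ (-(y * M)) := by
      refine sum_weight_ge_le hp L (n + 1) (filter_subset _ _) _ fun g hgm => ?_
      obtain ⟨hgP, hgx, -⟩ := mem_filter.1 hgm
      rcases hgap _ (weightSum_div_mem_nfoldSums hp (hmemA hgP) m) with h' | h'
      · rw [div_le_iff₀ hM] at h'
        exact absurd h' hgx.not_ge
      · rwa [le_div_iff₀ hM] at h'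
    rw [abs_mul, abs_of_nonneg (hf0 _ _)]
    calc _ ≤ |(Q.coeff (n + 1) : ℝ)| * ((2 * #A : ℝ) ^ (n + 1) * (p : ℝ) ^ (-(y * M))) := by gcongr
      _ = |(Q.coeff (n + 1) : ℝ)| * (2 * #A : ℝ) ^ (n + 1) * (p : ℝ) ^ (-(y * M)) := by ring
      _ ≤ _ := by
        gcongr
        exact single_le_sum (f := fun j => |(Q.coeff j : ℝ)| * (2 * #A : ℝ) ^ j)
          (fun _ _ => by positivity) (mem_range.2 (by omega))
  · obtain ⟨g, hgP, hgN⟩ := hg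
    have hgmid : g ∈ midS := by
      refine mem_filter.2 ⟨hgP, ?_, ?_⟩ <;> rw [hgN] <;> gcongr
      linarith
    rw [abs_mul, abs_of_nonneg (hf0 _ _)]
    calc _ ≤ f (n + 1) g := by
          simp only [f]
          rw [← hgN, Real.rpow_neg hp0.le, Real.rpow_natCast, ← mul_inv, ← pow_add]
          refine inv_anti₀ (by positivity) (pow_le_pow_right₀ hp1 ?_)
          have := hexp hgP le_rfl
          omega
      _ ≤ ∑ g ∈ midS, f (n + 1) g := single_le_sum (fun _ _ => by positivity) hgmid
      _ ≤ _ := le_mul_of_one_le_left (hf0 _ _) hcoef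

theorem transcendental_sum_tsum_inv_pow (hp : 1 < p) (hA : A.Nonempty) (ht : ∀ a ∈ A, 0 < t a) :
    Transcendental ℚ (∑ a ∈ A, ∑' v : ℕ, ((p : ℝ) ^ (v + t a * p ^ v))⁻¹) := by
  intro halg
  set γ : ℝ := ∑ a ∈ A, ∑' v : ℕ, ((p : ℝ) ^ (v + t a * p ^ v))⁻¹ with hγ
  obtain ⟨Q, hQ0, hQ⟩ := (IsFractionRing.isAlgebraic_iff ℤ ℚ ℝ).2 halg
  have hp0 : (0 : ℝ) < p := by positivity
  have hp1 : (1 : ℝ) < p := by exact_mod_cast hp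
  obtain ⟨n, hn⟩ : ∃ n, Q.natDegree = n + 1 := by
    refine Nat.exists_eq_succ_of_ne_zero fun h => ?_
    rw [Polynomial.eq_C_of_natDegree_eq_zero h] at hQ hQ0
    simp at hQ hQ0
    exact hQ0 hQ
  have hz : (0 : ℝ) ∈ powDilates p A t := Or.inl rfl
  obtain ⟨x, y, N, z, hx0, hxy, hyN, hNz, hN, hN', hgap, hgap'⟩ :=
    exists_gap_nfoldSums (isClosed_powDilates hp ht) countable_powDilates powDilates_nonneg hz
      (exists_small_mem_powDilates hp hA ht) n
  obtain ⟨K₀, hK₀⟩ := exists_weightSum_eq hp hN hN'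
  obtain ⟨K₁, hK₁⟩ := pow_unbounded_of_one_lt z hp1
  set K := max K₀ K₁
  have hzK : z ≤ (p : ℝ) ^ K :=
    hK₁.le.trans (pow_le_pow_right₀ hp1.le (le_max_right _ _))
  have hpartial : ∀ m : ℕ, |gapPartialSum p A t (m + K) - γ| ≤
      2 * #A * (p : ℝ) ^ (-(z * (p : ℝ) ^ m)) := by
    intro m
    refine (abs_gapPartialSum_sub_le hp ht (m + K)).trans ?_
    rw [← Real.rpow_natCast _ (p ^ (m + K)), ← Real.rpow_neg hp0.le]
    gcongr
    · exact hp1.le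
    · push_cast
      rw [pow_add, mul_comm]
      gcongr
  have hdecay0 := tendsto_pow_mul_rpow_neg_pow hp (2 * #A) 0 0 (hx0.trans_lt (by linarith) : 0 < z)
  simp only [zero_mul, pow_zero, mul_one] at hdecay0
  have hlim : Tendsto (fun m => gapPartialSum p A t (m + K)) atTop (𝓝 γ) :=
    tendsto_iff_norm_sub_tendsto_zero.2 (squeeze_zero (fun _ => norm_nonneg _) hpartial hdecay0)
  obtain ⟨c, hcpos, hc⟩ := ((Q.hasDerivAt_aeval γ).isBigO_sub.comp_tendsto hlim).exists_pos
  rw [Asymptotics.IsBigOWith] at hc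
  set C : ℝ := ∑ j ∈ range (n + 2), |(Q.coeff j : ℝ)| * (2 * #A : ℝ) ^ j with hC
  have hC0 : 0 ≤ C := sum_nonneg fun _ _ => by positivity
  set C' : ℝ := c * (2 * #A) with hC'
  have hC'0 : 0 ≤ C' := by positivity
  have hev1 := (tendsto_pow_mul_rpow_neg_pow hp (C' + 2 * C) (n + 1) K
    (sub_pos.2 hxy)).eventually (gt_mem_nhds one_pos)
  have hev2 := (tendsto_pow_mul_rpow_neg_pow hp (C' + C) (n + 1) K
    (sub_pos.2 hNz)).eventually (gt_mem_nhds one_pos)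
  obtain ⟨m, hcm, h1, h2, hm⟩ := (hc.and (hev1.and (hev2.and (eventually_ge_atTop K₀)))).exists
  obtain ⟨Z, mid, high, heq, hhigh, hmid, hmid'⟩ := aeval_gapPartialSum_eq hp hn hxy hyN hNz hgap
    (fun j hj s hs => hgap' s (nfoldSums_mono hz hj hs)) m (m + K)
    (hK₀ K (le_max_left _ _) m hm)
  simp only [Function.comp_apply, hQ, sub_zero, Real.norm_eq_abs] at hcm
  have hQm : |Polynomial.aeval (gapPartialSum p A t (m + K)) Q| ≤
      C' * (p : ℝ) ^ (-(z * (p : ℝ) ^ m)) := by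
    refine hcm.trans ?_
    rw [hC', mul_assoc]
    gcongr
    exact hpartial m
  set q := Polynomial.aeval (gapPartialSum p A t (m + K)) Q
  set M : ℝ := (p : ℝ) ^ m with hM
  have hM0 : 0 < M := by positivity
  have hzy : (p : ℝ) ^ (-(z * M)) ≤ (p : ℝ) ^ (-(y * M)) := by
    apply Real.rpow_le_rpow_of_exponent_le hp1.le
    nlinarith
  have hZ0 : Z = 0 := by
    have hD0 : (0 : ℝ) < (p : ℝ) ^ (⌊x * M⌋₊ + (n + 1) * (m + K)) := by positivity
    have hZeq : (Z : ℝ) = (q - mid - high) * (p : ℝ) ^ (⌊x * M⌋₊ + (n + 1) * (m + K)) := by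
      rw [heq]
      field_simp
      ring
    have hbound : |q - mid - high| ≤ (C' + 2 * C) * (p : ℝ) ^ (-(y * M)) := by
      have e1 := mul_le_mul_of_nonneg_left hzy hC'0
      have e2 := mul_le_mul_of_nonneg_left hzy hC0
      have e3 := abs_sub (q - mid) high
      have e4 := abs_sub q mid
      linarith
    have hDle : (p : ℝ) ^ (⌊x * M⌋₊ + (n + 1) * (m + K)) ≤
        (p : ℝ) ^ (x * M) * (p : ℝ) ^ ((n + 1) * (m + K)) := by
      rw [pow_add, ← Real.rpow_natCast _ ⌊x * M⌋₊]
      gcongr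
      · exact hp1.le
      · exact Nat.floor_le (by positivity)
    have hlt : |(Z : ℝ)| < 1 := by
      rw [hZeq, abs_mul, abs_of_pos hD0]
      calc _ ≤ (C' + 2 * C) * (p : ℝ) ^ (-(y * M)) *
            ((p : ℝ) ^ (x * M) * (p : ℝ) ^ ((n + 1) * (m + K))) :=
            mul_le_mul hbound hDle hD0.le
              (mul_nonneg (by linarith) (Real.rpow_nonneg hp0.le _))
        _ = (C' + 2 * C) * (p : ℝ) ^ ((n + 1) * (m + K)) * (p : ℝ) ^ (-((y - x) * M)) := by
            rw [show -((y - x) * M) = -(y * M) + x * M by ring, Real.rpow_add hp0]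
            ring
        _ < 1 := h1
    exact Int.abs_lt_one_iff.1 (by exact_mod_cast hlt)
  rw [hZ0, Int.cast_zero, zero_div, zero_add] at heq
  have hmidle : |mid| ≤ (C' + C) * (p : ℝ) ^ (-(z * M)) := by
    have e1 : mid = q - high := by rw [heq]; ring
    have e2 := abs_sub q high
    rw [e1]
    linarith
  have hfin := hmid'.trans hmidle
  rw [← div_eq_mul_inv, div_le_iff₀ (by positivity)] at hfin
  have hpN : (0 : ℝ) < (p : ℝ) ^ (-(N * M)) := by positivity
  have hlt := mul_lt_mul_of_pos_right h2 hpN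
  rw [show -((z - N) * M) = -(z * M) - -(N * M) by ring, Real.rpow_sub hp0, one_mul] at hlt
  refine absurd hfin (not_le.2 (lt_of_eq_of_lt ?_ hlt))
  field_simp

end Transcendence

section Density

open Finset

lemma tendsto_card_modEq_div {r : ℕ} (hr : 0 < r) (b : ℕ) :
    Tendsto (fun X : ℕ => (#{k ∈ Icc 1 X | k ≡ b [MOD r]} : ℝ) / X) atTop (𝓝 (1 / r)) := by
  have hr0 : (0 : ℚ) < r := by exact_mod_cast hr
  have hcard : ∀ X : ℕ, |(#{k ∈ Icc 1 X | k ≡ b [MOD r]} : ℝ) - X / r| ≤ 1 := by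
    intro X
    have h := Nat.Ioc_filter_modEq_card 0 X hr b
    rw [max_eq_left (sub_nonneg.2 (Int.floor_le_floor (by gcongr; simp)))] at h
    have h' : (#{k ∈ Icc 1 X | k ≡ b [MOD r]} : ℚ) =
        ⌊((X : ℚ) - b) / r⌋ - ⌊(((0 : ℕ) : ℚ) - b) / r⌋ := by exact_mod_cast h
    have e : ((X : ℚ) - b) / r = X / r + (((0 : ℕ) : ℚ) - b) / r := by
      push_cast
      ring
    have hq : |(#{k ∈ Icc 1 X | k ≡ b [MOD r]} : ℚ) - X / r| ≤ 1 := by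
      rw [h', abs_le]
      have h1 := Int.floor_le (((X : ℚ) - b) / r)
      have h2 := Int.lt_floor_add_one (((X : ℚ) - b) / r)
      have h3 := Int.floor_le ((((0 : ℕ) : ℚ) - b) / r)
      have h4 := Int.lt_floor_add_one ((((0 : ℕ) : ℚ) - b) / r)
      constructor <;> linarith
    have hr := (Rat.cast_le (K := ℝ)).2 hq
    push_cast at hr
    exact hr
  refine tendsto_iff_norm_sub_tendsto_zero.2 (squeeze_zero' (.of_forall fun _ => norm_nonneg _) ?_
    tendsto_one_div_atTop_nhds_zero_nat)
  filter_upwards [eventually_gt_atTop 0] with X hX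
  have hX0 : (0 : ℝ) < X := by exact_mod_cast hX
  rw [Real.norm_eq_abs, show (#{k ∈ Icc 1 X | k ≡ b [MOD r]} : ℝ) / X - 1 / r =
    (#{k ∈ Icc 1 X | k ≡ b [MOD r]} - X / r) / X by field_simp, abs_div, abs_of_pos hX0]
  gcongr
  exact hcard X

variable {p ϖ : ℕ}

lemma tendsto_card_mod_eq_and_pow_dvd_div (hp : p.Prime) (hϖ : 0 < ϖ) (hcop : ϖ.Coprime p)
    {a : ℕ} (ha : a < ϖ) (v : ℕ) :
    Tendsto (fun X : ℕ => (#{k ∈ Icc 1 X | k % ϖ = a ∧ p ^ v ∣ k} : ℝ) / X) atTop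
      (𝓝 (1 / (ϖ * p ^ v))) := by
  have hco : ϖ.Coprime (p ^ v) := hcop.pow_right v
  obtain ⟨b, hb1, hb2⟩ := Nat.chineseRemainder hco a 0
  have h := tendsto_card_modEq_div (Nat.mul_pos hϖ (pow_pos hp.pos v)) b
  push_cast at h
  refine h.congr fun X => ?_
  congr 3
  ext k
  simp only [mem_filter, ← Nat.modEq_and_modEq_iff_modEq_mul hco]
  refine and_congr_right fun _ => and_congr ?_ ?_
  · rw [Nat.ModEq, hb1, Nat.mod_eq_of_lt ha]
  · rw [Nat.ModEq, hb2, Nat.zero_mod, Nat.dvd_iff_mod_eq_zero]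

lemma tendsto_card_mod_eq_and_padicValNat_eq_div (hp : p.Prime) (hϖ : 0 < ϖ)
    (hcop : ϖ.Coprime p) {a : ℕ} (ha : a < ϖ) (v : ℕ) :
    Tendsto (fun X : ℕ => (#{k ∈ Icc 1 X | k % ϖ = a ∧ padicValNat p k = v} : ℝ) / X) atTop
      (𝓝 (1 / (ϖ * p ^ v) - 1 / (ϖ * p ^ (v + 1)))) := by
  have : Fact p.Prime := ⟨hp⟩
  refine ((tendsto_card_mod_eq_and_pow_dvd_div hp hϖ hcop ha v).sub
    (tendsto_card_mod_eq_and_pow_dvd_div hp hϖ hcop ha (v + 1))).congr fun X => ?_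
  rw [← sub_div]
  congr 1
  rw [sub_eq_iff_eq_add, ← Nat.cast_add, ← card_union_of_disjoint]
  · congr 2
    ext k
    simp only [mem_filter, mem_union, mem_Icc]
    by_cases hk : k = 0
    · simp [hk]
    · rw [padicValNat_dvd_iff_le hk, padicValNat_dvd_iff_le hk]
      omega
  · refine disjoint_left.2 fun k hk hk' => ?_
    simp only [mem_filter, mem_Icc] at hk hk'
    have := (padicValNat_dvd_iff_le (p := p) (show k ≠ 0 by omega)).1 hk'.2.2
    omega

lemma tendsto_sum_padicValNat_div (hp : p.Prime) (hϖ : 0 < ϖ) (hcop : ϖ.Coprime p)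
    {a : ℕ} (ha : a < ϖ) (H : ℕ → ℝ) (hH : ∀ v, |H v| ≤ 1) :
    Tendsto (fun X : ℕ => (∑ k ∈ Icc 1 X with k % ϖ = a, H (padicValNat p k)) / X) atTop
      (𝓝 (∑' v, H v * (1 / (ϖ * p ^ v) - 1 / (ϖ * p ^ (v + 1))))) := by
  have : Fact p.Prime := ⟨hp⟩
  have hp1 : (1 : ℝ) < p := by exact_mod_cast hp.one_lt
  have hsum : ∀ X : ℕ, (∑ k ∈ Icc 1 X with k % ϖ = a, H (padicValNat p k)) / (X : ℝ) =
      ∑' v, H v * ((#{k ∈ Icc 1 X | k % ϖ = a ∧ padicValNat p k = v} : ℝ) / X) := by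
    intro X
    have hmaps : ∀ k ∈ ({k ∈ Icc 1 X | k % ϖ = a} : Finset ℕ),
        padicValNat p k ∈ range (X + 1) := by
      intro k hk
      simp only [mem_filter, mem_Icc] at hk
      have := padicValNat_le_nat_log (p := p) k
      have := Nat.log_le_self p k
      exact mem_range.2 (by omega)
    rw [tsum_eq_sum (s := range (X + 1)), ← sum_fiberwise_of_maps_to hmaps, sum_div]
    · refine sum_congr rfl fun v _ => ?_
      rw [filter_filter, sum_congr rfl fun k hk => by rw [(mem_filter.1 hk).2.2], sum_const,
        nsmul_eq_mul]
      ring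
    · intro v hv
      rw [filter_eq_empty_iff.2 fun k hk (hk' : k % ϖ = a ∧ padicValNat p k = v) =>
        hv (hk'.2 ▸ (hmaps k (mem_filter.2 ⟨hk, hk'.1⟩)))]
      simp
  simp only [hsum]
  refine tendsto_tsum_of_dominated_convergence (bound := fun v => ((p : ℝ)⁻¹) ^ v)
    (summable_geometric_of_lt_one (by positivity) (inv_lt_one_of_one_lt₀ hp1))
    (fun v => (tendsto_card_mod_eq_and_padicValNat_eq_div hp hϖ hcop ha v).const_mul _)
    (.of_forall fun X v => ?_)
  rw [Real.norm_eq_abs, abs_mul, abs_of_nonneg (by positivity : (0 : ℝ) ≤ _ / _)]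
  refine (mul_le_of_le_one_left (by positivity) (hH v)).trans ?_
  have hcard : #{k ∈ Icc 1 X | k % ϖ = a ∧ padicValNat p k = v} ≤ X / p ^ v := by
    rw [← Nat.Ioc_filter_dvd_card_eq_div]
    refine card_le_card fun k hk => ?_
    simp only [mem_filter, mem_Icc, mem_Ioc] at hk ⊢
    exact ⟨by omega, (padicValNat_dvd_iff_le (by omega)).2 hk.2.2.ge⟩
  refine div_le_of_le_mul₀ (by positivity) (by positivity) ?_
  calc (#{k ∈ Icc 1 X | k % ϖ = a ∧ padicValNat p k = v} : ℝ) ≤ (X / p ^ v : ℕ) := by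
        exact_mod_cast hcard
    _ ≤ X / (p ^ v : ℕ) := Nat.cast_div_le
    _ = ((p : ℝ)⁻¹) ^ v * X := by
        push_cast
        rw [inv_pow]
        ring

end Density

lemma apply_eq_apply_mod_add {t : ℕ → ℕ} {ϖ : ℕ} (hϖ : 0 < ϖ)
    (hper : ∀ k, 1 ≤ k → t (k + ϖ) = t k) {k : ℕ} (hk : 1 ≤ k) : t k = t (k % ϖ + ϖ) := by
  have h : ∀ q l, 1 ≤ l → t (l + ϖ * q) = t l := by
    intro q l hl
    induction q with
    | zero => simp
    | succ q ih => rw [Nat.mul_succ, ← Nat.add_assoc, hper _ (by omega), ih]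
  rw [← hper k hk, ← h (k / ϖ) (k % ϖ + ϖ) (by omega)]
  congr 1
  have := Nat.mod_add_div k ϖ
  omega

lemma cesaroLim_inv_pow_mul_padicValNat {p : ℕ} (hp : p.Prime) {ϖ : ℕ} (hϖ : 0 < ϖ)
    (hcop : ϖ.Coprime p) {t : ℕ → ℕ} (hper : ∀ k, 1 ≤ k → t (k + ϖ) = t k) :
    CesaroLim (fun k => ((p : ℝ) ^ (t k * p ^ padicValNat p k))⁻¹)
      ((1 - (p : ℝ)⁻¹) / ϖ *
        ∑ a ∈ Finset.range ϖ, ∑' v : ℕ, ((p : ℝ) ^ (v + t (a + ϖ) * p ^ v))⁻¹) := by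
  have hp1 : (1 : ℝ) ≤ p := by exact_mod_cast hp.one_lt.le
  have hp0 : (p : ℝ) ≠ 0 := by positivity
  have hϖ0 : (ϖ : ℝ) ≠ 0 := by positivity
  have h := tendsto_finsetSum (Finset.range ϖ) fun a ha =>
    tendsto_sum_padicValNat_div hp hϖ hcop (Finset.mem_range.1 ha)
      (fun v => ((p : ℝ) ^ (t (a + ϖ) * p ^ v))⁻¹) fun v => by
        rw [abs_of_nonneg (by positivity)]
        exact inv_le_one_of_one_le₀ (one_le_pow₀ hp1)
  rw [CesaroLim, Finset.mul_sum]
  convert h using 2 with X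
  · rw [← Finset.sum_div]
    congr 1
    rw [← Finset.sum_fiberwise_of_maps_to
      (fun k _ => Finset.mem_range.2 (Nat.mod_lt k hϖ))]
    refine Finset.sum_congr rfl fun a _ => Finset.sum_congr rfl fun k hk => ?_
    obtain ⟨hk1, hka⟩ := Finset.mem_filter.1 hk
    rw [apply_eq_apply_mod_add hϖ hper (Finset.mem_Icc.1 hk1).1, hka]
  · refine Finset.sum_congr rfl fun a _ => ?_
    rw [← tsum_mul_left]
    refine tsum_congr fun v => ?_
    rw [pow_add, pow_succ]
    field_simp

/-- For a confined endomorphism of a vector group over `𝔽̄_p` (equivalently, an additive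
cellular automaton on the alphabet `𝔽_p^r`), with `σ_k = p^{kc - t_k p^{v_p(k)}}` and
`Λ = p^c`: the Cesàro mean `B = 𝒞(p^{-t_k p^{v_p(k)}})` exists, and either `t_k = 0` for
all `k ≥ 1` and `B = 1`, or some `t_a ≠ 0` and `B` is transcendental. -/
theorem cellular_automaton_cesaro (p : ℕ) (hp : p.Prime)
    (ϖ : ℕ) (hϖ : 0 < ϖ) (hcop : Nat.Coprime ϖ p)
    (t : ℕ → ℕ) (hper : ∀ k, 1 ≤ k → t (k + ϖ) = t k) :
    ∃ B : ℝ,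
      CesaroLim (fun k => ((p : ℝ) ^ (t k * p ^ padicValNat p k))⁻¹) B ∧
      ((∀ k, 1 ≤ k → t k = 0) → B = 1) ∧
      ((∃ k, 1 ≤ k ∧ t k ≠ 0) → Transcendental ℚ B) := by
  have hlim := cesaroLim_inv_pow_mul_padicValNat hp hϖ hcop hper
  refine ⟨_, hlim, fun hzero => ?_, ?_⟩
  · refine tendsto_nhds_unique hlim (tendsto_const_nhds.congr' ?_)
    filter_upwards [eventually_gt_atTop 0] with X hX
    rw [Finset.sum_congr rfl fun k hk => by rw [hzero k (Finset.mem_Icc.1 hk).1]]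
    have : (X : ℝ) ≠ 0 := by positivity
    simp [this]
  · rintro ⟨k, hk, hk0⟩
    set A := (Finset.range ϖ).filter fun a => t (a + ϖ) ≠ 0 with hA
    have hAne : A.Nonempty := by
      refine ⟨k % ϖ, Finset.mem_filter.2 ⟨Finset.mem_range.2 (Nat.mod_lt k hϖ), ?_⟩⟩
      rwa [← apply_eq_apply_mod_add hϖ hper hk]
    have htr := transcendental_sum_tsum_inv_pow (t := fun a => t (a + ϖ)) hp.one_lt hAne
      fun a ha => Nat.pos_of_ne_zero (Finset.mem_filter.1 ha).2
    have hp1 : (1 : ℝ) < p := by exact_mod_cast hp.one_lt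
    have hgeom : ∑' v : ℕ, ((p : ℝ) ^ v)⁻¹ = (1 - (p : ℝ)⁻¹)⁻¹ := by
      simp_rw [← inv_pow]
      exact tsum_geometric_of_lt_one (by positivity) (inv_lt_one_of_one_lt₀ hp1)
    have hrest : ∑ a ∈ Finset.range ϖ with ¬ t (a + ϖ) ≠ 0,
        ∑' v : ℕ, ((p : ℝ) ^ (v + t (a + ϖ) * p ^ v))⁻¹ =
          ((Finset.card {a ∈ Finset.range ϖ | ¬ t (a + ϖ) ≠ 0} * (1 - (p : ℚ)⁻¹)⁻¹ : ℚ) : ℝ) := by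
      rw [Finset.sum_congr rfl fun a ha => by
        rw [not_not.1 (Finset.mem_filter.1 ha).2]]
      simp [hgeom]
    have hc : (1 - (p : ℚ)⁻¹) / ϖ ≠ 0 := by
      have : (p : ℚ)⁻¹ < 1 := inv_lt_one_of_one_lt₀ (by exact_mod_cast hp.one_lt)
      have : (ϖ : ℚ) ≠ 0 := by positivity
      exact div_ne_zero (by linarith) this
    rw [← Finset.sum_filter_add_sum_filter_not _ fun a => t (a + ϖ) ≠ 0, hrest]
    intro halg
    refine htr ?_
    set c : ℚ := (1 - (p : ℚ)⁻¹) / ϖ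
    have hcr : (1 - (p : ℝ)⁻¹) / ϖ = (c : ℝ) := by simp [c]
    rw [hcr] at halg
    have h1 := ((isAlgebraic_algebraMap (R := ℚ) (A := ℝ) c⁻¹).mul halg).sub
      (isAlgebraic_algebraMap (R := ℚ) (A := ℝ)
        (Finset.card {a ∈ Finset.range ϖ | ¬ t (a + ϖ) ≠ 0} * (1 - (p : ℚ)⁻¹)⁻¹))
    have hc' : (c : ℝ) ≠ 0 := by exact_mod_cast hc
    rw [eq_ratCast, eq_ratCast, Rat.cast_inv, inv_mul_cancel_left₀ hc', add_sub_cancel_right] at h1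
    exact h1
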